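/- For every k ∈ ℕ, ∫₀^∞ h_{2k+1}(t) dt = (2^{k+1} k! / √(2 · (2k+1)! · √π)) · Σ_{i=0}^k C(−1/2, i), where C(−1/2,i) = (−1)^i C(i−1/2, i) is the generalized binomial coefficient. -/

import Mathlib

open MeasureTheory Real

/-- The normalized Hermite function of degree `k`:
`h_k(t) = (−1)^k (2^k k! √π)^{−1/2} e^{t²/2} (d/dt)^k(e^{−t²})`. -/
noncomputable def hermiteFun (k : ℕ) (t : ℝ) : ℝ :=
  (-1 : ℝ) ^ k * ((2 : ℝ) ^ k * (Nat.factorial k : ℝ) * Real.sqrt π) ^ (-(1 : ℝ) / 2) *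
    Real.exp (t ^ 2 / 2) * iteratedDeriv k (fun s : ℝ => Real.exp (-s ^ 2)) t

/-- Generalized binomial coefficient `C(a,i) = a(a−1)⋯(a−i+1)/i!`. -/
noncomputable def genBinom (a : ℝ) (i : ℕ) : ℝ :=
  (∏ j ∈ Finset.range i, (a - j)) / (Nat.factorial i : ℝ)

open Polynomial in
/-- The physicists' Hermite polynomials. -/
noncomputable def physHermite : ℕ → ℝ[X]
  | 0 => 1
  | k + 1 => 2 * X * physHermite k - derivative (physHermite k)

open Polynomial in
theorem derivative_physHermite_succ (k : ℕ) :
    derivative (physHermite (k + 1)) = 2 * ((k : ℝ[X]) + 1) * physHermite k := by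
  induction k with
  | zero => simp [physHermite]
  | succ k ih =>
    rw [physHermite, derivative_sub, ih]
    simp only [derivative_mul, derivative_ofNat, derivative_X, derivative_add,
      derivative_natCast, derivative_one, ih]
    rw [physHermite]
    push_cast
    ring

open Polynomial in
theorem iteratedDeriv_exp_neg_sq (k : ℕ) (t : ℝ) :
    iteratedDeriv k (fun s : ℝ => Real.exp (-s ^ 2)) t =
      (-1) ^ k * (physHermite k).eval t * Real.exp (-t ^ 2) := by
  induction k generalizing t with
  | zero => simp [physHermite]
  | succ k ih =>
    rw [iteratedDeriv_succ, funext ih]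
    have hexp : HasDerivAt (fun s : ℝ => Real.exp (-s ^ 2)) (Real.exp (-t ^ 2) * (-(2 * t))) t := by
      simpa using ((hasDerivAt_pow 2 t).neg).exp
    refine ((((physHermite k).hasDerivAt t).const_mul ((-1) ^ k)).mul hexp).deriv.trans ?_
    simp only [physHermite, eval_sub, eval_mul, eval_ofNat, eval_X]
    ring

theorem hermiteFun_eq (k : ℕ) (t : ℝ) :
    hermiteFun k t = ((2 : ℝ) ^ k * (Nat.factorial k : ℝ) * Real.sqrt π) ^ (-(1 : ℝ) / 2) *
      ((physHermite k).eval t * Real.exp (-t ^ 2 / 2)) := by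
  have hexp : Real.exp (t ^ 2 / 2) * Real.exp (-t ^ 2) = Real.exp (-t ^ 2 / 2) := by
    rw [← Real.exp_add]; congr 1; ring
  have hsign : ((-1 : ℝ) ^ k) * (-1) ^ k = 1 := by rw [← mul_pow]; simp
  rw [hermiteFun, iteratedDeriv_exp_neg_sq, ← hexp]
  linear_combination ((2 : ℝ) ^ k * (Nat.factorial k : ℝ) * Real.sqrt π) ^ (-(1 : ℝ) / 2) *
      (physHermite k).eval t * Real.exp (t ^ 2 / 2) * Real.exp (-t ^ 2) * hsign

theorem integrable_polynomial_mul_gaussian (p : Polynomial ℝ) :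
    Integrable (fun t : ℝ => p.eval t * Real.exp (-t ^ 2 / 2)) := by
  induction p using Polynomial.induction_on' with
  | add p q hp hq =>
    simp only [Polynomial.eval_add, add_mul]
    exact hp.add hq
  | monomial n a =>
    have h := integrable_rpow_mul_exp_neg_mul_sq (b := 1 / 2) (by norm_num) (s := n)
      (by have : (0 : ℝ) ≤ n := n.cast_nonneg
          linarith)
    refine (h.const_mul a).congr (Filter.Eventually.of_forall fun t => ?_)
    simp only [Polynomial.eval_monomial, Real.rpow_natCast]
    rw [mul_assoc]
    congr 3
    ring

theorem integral_Ioi_physHermite_add_two (k : ℕ) :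
    ∫ t in Set.Ioi (0 : ℝ), (physHermite (k + 2)).eval t * Real.exp (-t ^ 2 / 2) =
      2 * ((k : ℝ) + 1) * (∫ t in Set.Ioi (0 : ℝ), (physHermite k).eval t * Real.exp (-t ^ 2 / 2)) +
        2 * (physHermite (k + 1)).eval 0 := by
  have hderiv (t : ℝ) :
      HasDerivAt (fun s : ℝ => (physHermite (k + 1)).eval s * Real.exp (-s ^ 2 / 2))
        (((k : ℝ) + 1) * ((physHermite k).eval t * Real.exp (-t ^ 2 / 2)) -
          1 / 2 * ((physHermite (k + 2)).eval t * Real.exp (-t ^ 2 / 2))) t := by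
    have hexp : HasDerivAt (fun s : ℝ => Real.exp (-s ^ 2 / 2))
        (Real.exp (-t ^ 2 / 2) * (-t)) t := by
      have h := (((hasDerivAt_pow 2 t).neg).div_const 2).exp
      refine h.congr_deriv ?_
      simp only [Pi.neg_apply]
      push_cast
      ring
    refine (((physHermite (k + 1)).hasDerivAt t).mul hexp).congr_deriv ?_
    have hrec : physHermite (k + 2) = 2 * Polynomial.X * physHermite (k + 1) -
        Polynomial.derivative (physHermite (k + 1)) := rfl
    rw [hrec, derivative_physHermite_succ]
    simp only [Polynomial.eval_sub, Polynomial.eval_mul, Polynomial.eval_ofNat, Polynomial.eval_X,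
      Polynomial.eval_add, Polynomial.eval_natCast, Polynomial.eval_one]
    ring
  have hI (j : ℕ) := (integrable_polynomial_mul_gaussian (physHermite j)).integrableOn
    (s := Set.Ioi 0)
  have hI₁ := (hI k).const_mul ((k : ℝ) + 1)
  have hI₂ := (hI (k + 2)).const_mul (1 / 2)
  have hlim := tendsto_zero_of_hasDerivAt_of_integrableOn_Ioi (fun t _ => hderiv t)
    (hI₁.sub hI₂) (hI (k + 1))
  have h := integral_Ioi_of_hasDerivAt_of_tendsto' (fun t _ => hderiv t) (hI₁.sub hI₂) hlim
  rw [integral_sub hI₁ hI₂, integral_const_mul, integral_const_mul] at h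
  norm_num at h
  linarith

theorem genBinom_succ (a : ℝ) (i : ℕ) :
    genBinom a (i + 1) = genBinom a i * (a - i) / (i + 1) := by
  have : (i : ℝ) + 1 ≠ 0 := by positivity
  rw [genBinom, genBinom, Finset.prod_range_succ, Nat.factorial_succ]
  push_cast
  field_simp

theorem physHermite_eval_zero (m : ℕ) :
    (physHermite (2 * m)).eval 0 = 4 ^ m * (Nat.factorial m : ℝ) * genBinom (-(1 / 2)) m := by
  induction m with
  | zero => simp [physHermite, genBinom]
  | succ m ih =>
    have : (m : ℝ) + 1 ≠ 0 := by positivity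
    rw [show 2 * (m + 1) = (2 * m + 1) + 1 from rfl, physHermite, derivative_physHermite_succ,
      genBinom_succ, Nat.factorial_succ]
    simp only [Polynomial.eval_sub, Polynomial.eval_mul, Polynomial.eval_ofNat, Polynomial.eval_X,
      Polynomial.eval_add, Polynomial.eval_natCast, Polynomial.eval_one, ih]
    push_cast
    field_simp
    ring

theorem integral_Ioi_physHermite_one :
    ∫ t in Set.Ioi (0 : ℝ), (physHermite 1).eval t * Real.exp (-t ^ 2 / 2) = 2 := by
  have hderiv (t : ℝ) : HasDerivAt (fun s : ℝ => (Polynomial.C (-2)).eval s * Real.exp (-s ^ 2 / 2))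
      ((physHermite 1).eval t * Real.exp (-t ^ 2 / 2)) t := by
    have h := ((((hasDerivAt_pow 2 t).neg).div_const 2).exp).const_mul (-2)
    simp only [Polynomial.eval_C]
    refine h.congr_deriv ?_
    simp [physHermite]
    ring
  have hI (p : Polynomial ℝ) := (integrable_polynomial_mul_gaussian p).integrableOn
    (s := Set.Ioi 0)
  have hlim := tendsto_zero_of_hasDerivAt_of_integrableOn_Ioi (fun t _ => hderiv t)
    (hI _) (hI _)
  rw [integral_Ioi_of_hasDerivAt_of_tendsto' (fun t _ => hderiv t) (hI _) hlim]
  norm_num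

theorem integral_Ioi_physHermite_odd (k : ℕ) :
    ∫ t in Set.Ioi (0 : ℝ), (physHermite (2 * k + 1)).eval t * Real.exp (-t ^ 2 / 2) =
      2 * 4 ^ k * (Nat.factorial k : ℝ) * ∑ i ∈ Finset.range (k + 1), genBinom (-(1 / 2)) i := by
  induction k with
  | zero => simpa [genBinom] using integral_Ioi_physHermite_one
  | succ k ih =>
    rw [show 2 * (k + 1) + 1 = (2 * k + 1) + 2 from rfl, integral_Ioi_physHermite_add_two, ih,
      show 2 * k + 1 + 1 = 2 * (k + 1) from rfl, physHermite_eval_zero,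
      Finset.sum_range_succ _ (k + 1), Nat.factorial_succ]
    push_cast
    ring

theorem odd_hermite_half_line_integral (k : ℕ) :
    (∫ t in Set.Ioi (0 : ℝ), hermiteFun (2 * k + 1) t)
      = ((2 : ℝ) ^ (k + 1) * (Nat.factorial k : ℝ) /
          Real.sqrt (2 * (Nat.factorial (2 * k + 1) : ℝ) * Real.sqrt π)) *
        ∑ i ∈ Finset.range (k + 1), genBinom (-(1 / 2)) i := by
  have hnorm : ((2 : ℝ) ^ (2 * k + 1) * (Nat.factorial (2 * k + 1) : ℝ) * √π) ^ (-(1 : ℝ) / 2) =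
      (2 ^ k * √(2 * (Nat.factorial (2 * k + 1) : ℝ) * √π))⁻¹ := by
    rw [neg_div, Real.rpow_neg (by positivity), ← Real.sqrt_eq_rpow,
      ← Real.sqrt_sq (show (0 : ℝ) ≤ 2 ^ k by positivity), ← Real.sqrt_mul (by positivity)]
    congr 2
    ring
  have hsqrt : √(2 * (Nat.factorial (2 * k + 1) : ℝ) * √π) ≠ 0 := by positivity
  simp_rw [hermiteFun_eq]
  rw [integral_const_mul, integral_Ioi_physHermite_odd, hnorm,
    show (4 : ℝ) = 2 * 2 by norm_num, mul_pow]
  field_simp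
  ring
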